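/- Decay at infinity of the fractional Laplacian of the weight: let α ∈ (0,2), k ∈ (0,α), m(x) = (1+|x|²)^{k/2} on ℝ^d, and define I[m](x) by the symmetrized integral -(1/2)∫ (m(x+z)+m(x-z)-2m(x))/|z|^{d+α} dz restricted to |z|≤1 plus ∫_{|x-y|≥1} (m(y)-m(x))/|x-y|^{d+α} dy. Then I[m](x)/m(x) → 0 as |x| → ∞; in fact |I[m](x)| ≤ C(⟨x⟩^{k-2} + |x|^{k/2} + 1) for some constant C. -/

import Mathlib

open MeasureTheory Real Set Filter

noncomputable def fracLapWeight (d : ℕ) (α k : ℝ) (x : EuclideanSpace ℝ (Fin d)) : ℝ :=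
  -(1 / 2 : ℝ) * (∫ z in {z : EuclideanSpace ℝ (Fin d) | ‖z‖ ≤ 1},
      ((1 + ‖x + z‖ ^ 2) ^ (k / 2) + (1 + ‖x - z‖ ^ 2) ^ (k / 2)
        - 2 * (1 + ‖x‖ ^ 2) ^ (k / 2)) / ‖z‖ ^ ((d : ℝ) + α)) +
    ∫ y in {y : EuclideanSpace ℝ (Fin d) | 1 ≤ ‖x - y‖},
      ((1 + ‖y‖ ^ 2) ^ (k / 2) - (1 + ‖x‖ ^ 2) ^ (k / 2)) / ‖x - y‖ ^ ((d : ℝ) + α)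


lemma aux_lower {p u : ℝ} (hp0 : 0 < p) (hp1 : p < 1) (hu : 0 < u) :
    1 + p * (u - 1) - (u - 1) ^ 2 ≤ u ^ p := by
  have h1 : u ^ (1 - p) ≤ 1 + (1 - p) * (u - 1) := by
    have := _root_.rpow_one_add_le_one_add_mul_self (s := u - 1) (by linarith)
      (p := 1 - p) (by linarith) (by linarith)
    simpa using this
  have h2 : u ^ p * u ^ (1 - p) = u := by
    rw [← Real.rpow_add hu]; simp
  have h3 : 0 < u ^ p := Real.rpow_pos_of_pos hu p
  have hw : p ≤ 1 + (1 - p) * (u - 1) := by nlinarith [mul_pos (sub_pos.2 hp1) hu]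
  have h4 : u ≤ u ^ p * (1 + (1 - p) * (u - 1)) := by
    calc u = u ^ p * u ^ (1 - p) := h2.symm
      _ ≤ _ := by gcongr
  by_contra hcon
  push Not at hcon
  have hwpos : 0 < 1 + (1 - p) * (u - 1) := by linarith
  have h5 : u < (1 + p * (u - 1) - (u - 1) ^ 2) * (1 + (1 - p) * (u - 1)) :=
    lt_of_le_of_lt h4 (mul_lt_mul_of_pos_right hcon hwpos)
  have h6 : (1 + p * (u - 1) - (u - 1) ^ 2) * (1 + (1 - p) * (u - 1)) =
      u + (u - 1) ^ 2 * (p * (1 - p) - (1 + (1 - p) * (u - 1))) := by ring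
  have h7 : (u - 1) ^ 2 * (p * (1 - p) - (1 + (1 - p) * (u - 1))) ≤ 0 :=
    mul_nonpos_of_nonneg_of_nonpos (sq_nonneg _) (by nlinarith)
  linarith

lemma aux_upper {p u : ℝ} (hp0 : 0 < p) (hp1 : p < 1) (hu : 0 < u) :
    u ^ p ≤ 1 + p * (u - 1) := by
  have := _root_.rpow_one_add_le_one_add_mul_self (s := u - 1) (by linarith)
    (p := p) (by linarith) (by linarith)
  simpa using this

lemma aux_second {p a s b : ℝ} (hp0 : 0 < p) (hp1 : p < 1) (ha : 1 ≤ a) (hs : 0 ≤ s)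
    (h1 : 0 < a + s + b) (h2 : 0 < a + s - b) (hb : b ^ 2 ≤ 4 * a * s) :
    |(a + s + b) ^ p + (a + s - b) ^ p - 2 * a ^ p| ≤ 8 * s := by
  have ha0 : 0 < a := by linarith
  have hc : 0 < a + s := by linarith
  set c := a + s with hcdef
  have e1 : (c + b) ^ p = c ^ p * ((c + b) / c) ^ p := by
    rw [← Real.mul_rpow hc.le (by positivity)]; congr 1; field_simp
  have e2 : (c - b) ^ p = c ^ p * ((c - b) / c) ^ p := by
    rw [← Real.mul_rpow hc.le (by positivity)]; congr 1; field_simp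
  have e3 : c ^ p = a ^ p * (c / a) ^ p := by
    rw [← Real.mul_rpow ha0.le (by positivity)]; congr 1; field_simp
  have f1 : (c + b) / c - 1 = b / c := by field_simp; ring
  have f2 : (c - b) / c - 1 = -(b / c) := by field_simp; ring
  have f3 : c / a - 1 = s / a := by field_simp; rw [hcdef]; ring
  have l1 := aux_lower hp0 hp1 (div_pos h1 hc)
  have l2 := aux_lower hp0 hp1 (div_pos h2 hc)
  have u1 := aux_upper hp0 hp1 (div_pos h1 hc)
  have u2 := aux_upper hp0 hp1 (div_pos h2 hc)
  have u3 := aux_upper hp0 hp1 (div_pos hc ha0)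
  rw [f1] at l1 u1
  rw [f2] at l2 u2
  rw [f3] at u3
  have hcp : 0 < c ^ p := Real.rpow_pos_of_pos hc p
  have hap : 0 < a ^ p := Real.rpow_pos_of_pos ha0 p
  have hcc : c ^ p ≤ c := by
    simpa using Real.rpow_le_rpow_of_exponent_le (show 1 ≤ c by linarith) hp1.le
  have haa : a ^ p ≤ a := by
    simpa using Real.rpow_le_rpow_of_exponent_le ha hp1.le
  have hac : a ^ p ≤ c ^ p := Real.rpow_le_rpow ha0.le (by linarith) hp0.le
  have hca : c ^ p ≤ a ^ p + s := by
    rw [e3]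
    have : a ^ p * (c / a) ^ p ≤ a ^ p * (1 + p * (s / a)) := by gcongr
    have h' : a ^ p * (p * (s / a)) ≤ a * (1 * (s / a)) := by gcongr
    have h'' : a * (1 * (s / a)) = s := by field_simp
    linarith
  have hq : c ^ p * (b / c) ^ 2 ≤ 4 * s := by
    have : c ^ p * (b / c) ^ 2 ≤ c * (b / c) ^ 2 := by gcongr
    have h' : c * (b / c) ^ 2 = b ^ 2 / c := by field_simp
    have h'' : b ^ 2 / c ≤ 4 * s := by
      rw [div_le_iff₀ hc]; nlinarith
    linarith
  have L1 := mul_le_mul_of_nonneg_left l1 hcp.le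
  have L2 := mul_le_mul_of_nonneg_left l2 hcp.le
  have U1 := mul_le_mul_of_nonneg_left u1 hcp.le
  have U2 := mul_le_mul_of_nonneg_left u2 hcp.le
  rw [← e1] at L1 U1
  rw [← e2] at L2 U2
  rw [abs_le]
  constructor <;> nlinarith

lemma aux_first {p a b : ℝ} (hp0 : 0 < p) (hp1 : p < 1) (ha : 0 ≤ a) (hb : 0 ≤ b) :
    |a ^ p - b ^ p| ≤ |a - b| ^ p := by
  have key : ∀ x y : ℝ, 0 ≤ y → y ≤ x → |x ^ p - y ^ p| ≤ |x - y| ^ p := by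
    intro x y hy hxy
    rw [abs_of_nonneg (sub_nonneg.2 hxy),
      abs_of_nonneg (sub_nonneg.2 (Real.rpow_le_rpow hy hxy hp0.le))]
    have := Real.rpow_add_le_add_rpow hy (sub_nonneg.2 hxy) hp0.le hp1.le
    rw [add_sub_cancel] at this
    linarith
  rcases le_total b a with h | h
  · exact key a b hb h
  · rw [abs_sub_comm, abs_sub_comm a b]; exact key b a ha h

lemma aux_near {d : ℕ} {k : ℝ} (hk0 : 0 < k) (hk2 : k < 2) (x z : EuclideanSpace ℝ (Fin d)) :
    |(1 + ‖x + z‖ ^ 2) ^ (k / 2) + (1 + ‖x - z‖ ^ 2) ^ (k / 2)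
        - 2 * (1 + ‖x‖ ^ 2) ^ (k / 2)| ≤ 8 * ‖z‖ ^ 2 := by
  have e1 : 1 + ‖x + z‖ ^ 2 = (1 + ‖x‖ ^ 2) + ‖z‖ ^ 2 + 2 * inner ℝ x z := by
    rw [norm_add_sq_real]; ring
  have e2 : 1 + ‖x - z‖ ^ 2 = (1 + ‖x‖ ^ 2) + ‖z‖ ^ 2 - 2 * inner ℝ x z := by
    rw [norm_sub_sq_real]; ring
  have h1 : 0 < 1 + ‖x + z‖ ^ 2 := by positivity
  have h2 : 0 < 1 + ‖x - z‖ ^ 2 := by positivity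
  rw [e1] at h1
  rw [e2] at h2
  rw [e1, e2]
  apply aux_second (by linarith) (by linarith) (by nlinarith [sq_nonneg ‖x‖]) (by positivity) h1 h2
  have h3 := abs_real_inner_le_norm x z
  have h4 : (inner ℝ x z) ^ 2 ≤ (‖x‖ * ‖z‖) ^ 2 := sq_le_sq' (abs_le.1 h3).1 (abs_le.1 h3).2
  nlinarith [sq_nonneg ‖z‖]

lemma aux_far {d : ℕ} {k : ℝ} (hk0 : 0 < k) (hk2 : k < 2) (x y : EuclideanSpace ℝ (Fin d))
    (h : 1 ≤ ‖x - y‖) :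
    |(1 + ‖y‖ ^ 2) ^ (k / 2) - (1 + ‖x‖ ^ 2) ^ (k / 2)| ≤
      (2 * ‖x‖ ^ (k / 2) + 1) * ‖x - y‖ ^ k := by
  refine (aux_first (by linarith) (by linarith) (by positivity) (by positivity)).trans ?_
  have e : 1 + ‖y‖ ^ 2 - (1 + ‖x‖ ^ 2) = ‖x - y‖ ^ 2 - 2 * inner ℝ x (x - y) := by
    have : y = x - (x - y) := by abel
    conv_lhs => rw [this]
    rw [norm_sub_sq_real]; ring
  set w := x - y
  have h3 := abs_real_inner_le_norm x w
  have hw0 : 0 < ‖w‖ := by linarith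
  have h4 : |1 + ‖y‖ ^ 2 - (1 + ‖x‖ ^ 2)| ≤ 2 * ‖x‖ * ‖w‖ + ‖w‖ ^ 2 := by
    rw [e, abs_le]
    have := abs_le.1 h3
    constructor <;> nlinarith [sq_nonneg ‖w‖]
  have h5 : 2 * ‖x‖ * ‖w‖ + ‖w‖ ^ 2 ≤ (2 * ‖x‖ + 1) * ‖w‖ ^ 2 := by
    nlinarith [norm_nonneg x, mul_nonneg (norm_nonneg x) hw0.le]
  calc |1 + ‖y‖ ^ 2 - (1 + ‖x‖ ^ 2)| ^ (k / 2)
      ≤ ((2 * ‖x‖ + 1) * ‖w‖ ^ 2) ^ (k / 2) :=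
        Real.rpow_le_rpow (abs_nonneg _) (h4.trans h5) (by linarith)
    _ = (2 * ‖x‖ + 1) ^ (k / 2) * ‖w‖ ^ k := by
        rw [Real.mul_rpow (by positivity) (by positivity), ← Real.rpow_natCast,
          ← Real.rpow_mul hw0.le]
        congr 2; push_cast; ring
    _ ≤ _ := by
        gcongr
        have := Real.rpow_add_le_add_rpow (show 0 ≤ 2 * ‖x‖ by positivity) zero_le_one
          (show 0 ≤ k / 2 by linarith) (by linarith)
        rw [Real.one_rpow, Real.mul_rpow (by norm_num) (norm_nonneg _)] at this
        have h2 : (2:ℝ) ^ (k / 2) ≤ 2 := by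
          simpa using Real.rpow_le_rpow_of_exponent_le (show (1:ℝ) ≤ 2 by norm_num)
            (show k / 2 ≤ 1 by linarith)
        have := mul_le_mul_of_nonneg_right h2 (Real.rpow_nonneg (norm_nonneg x) (k / 2))
        linarith

lemma aux_int_near {d : ℕ} (hd : 1 ≤ d) {β : ℝ} (hβ : 0 < β) :
    Integrable (fun z : EuclideanSpace ℝ (Fin d) =>
      (Iic (1:ℝ)).indicator (fun r => r ^ (β - d)) ‖z‖) := by
  have : Nonempty (Fin d) := ⟨⟨0, hd⟩⟩
  rw [integrable_fun_norm_addHaar volume (f := (Iic (1:ℝ)).indicator (fun r => r ^ (β - d)))]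
  have h : IntegrableOn (fun r : ℝ => r ^ (β - 1)) (Ioc 0 1) := by
    have := intervalIntegral.intervalIntegrable_rpow' (a := 0) (b := 1) (r := β - 1) (by linarith)
    rwa [intervalIntegrable_iff_integrableOn_Ioc_of_le zero_le_one] at this
  have h' := h.integrable_indicator measurableSet_Ioc
  refine (h'.integrableOn (s := Ioi 0)).congr_fun ?_ measurableSet_Ioi
  intro r hr
  have hr : 0 < r := hr
  by_cases h1 : r ≤ 1
  · simp only [finrank_euclideanSpace, Fintype.card_fin, smul_eq_mul]
    rw [indicator_of_mem (show r ∈ Ioc 0 1 from ⟨hr, h1⟩), indicator_of_mem (show r ∈ Iic 1 from h1),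
      ← Real.rpow_natCast, ← Real.rpow_add hr]
    congr 1
    push_cast [hd]; ring
  · rw [indicator_of_notMem (show r ∉ Ioc 0 1 from fun h => h1 h.2)]
    simp [h1]

lemma aux_int_far {d : ℕ} (hd : 1 ≤ d) {β : ℝ} (hβ : β < 0) :
    Integrable (fun z : EuclideanSpace ℝ (Fin d) =>
      (Ici (1:ℝ)).indicator (fun r => r ^ (β - d)) ‖z‖) := by
  have : Nonempty (Fin d) := ⟨⟨0, hd⟩⟩
  rw [integrable_fun_norm_addHaar volume (f := (Ici (1:ℝ)).indicator (fun r => r ^ (β - d)))]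
  have h : IntegrableOn (fun r : ℝ => r ^ (β - 1)) (Ici 1) := by
    rw [integrableOn_Ici_iff_integrableOn_Ioi]
    exact integrableOn_Ioi_rpow_of_lt (by linarith) one_pos
  have h' := h.integrable_indicator measurableSet_Ici
  refine (h'.integrableOn (s := Ioi 0)).congr_fun ?_ measurableSet_Ioi
  intro r hr
  have hr : 0 < r := hr
  by_cases h1 : 1 ≤ r
  · simp only [finrank_euclideanSpace, Fintype.card_fin, smul_eq_mul]
    rw [indicator_of_mem (show r ∈ Ici 1 from h1), indicator_of_mem (show r ∈ Ici 1 from h1),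
      ← Real.rpow_natCast, ← Real.rpow_add hr]
    congr 1
    push_cast [hd]; ring
  · rw [indicator_of_notMem (show r ∉ Ici 1 from h1)]
    simp [h1]

lemma aux_bound (d : ℕ) (hd : 1 ≤ d) (α : ℝ) (hα : α ∈ Set.Ioo (0:ℝ) 2)
    (k : ℝ) (hk : k ∈ Set.Ioo 0 α) :
    ∃ C > (0 : ℝ), ∀ x : EuclideanSpace ℝ (Fin d),
      |fracLapWeight d α k x| ≤ C * (‖x‖ ^ (k / 2) + 1) := by
  obtain ⟨hα0, hα2⟩ := hα
  obtain ⟨hk0, hkα⟩ := hk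
  have hk2 : k < 2 := by linarith
  have I1 := aux_int_near hd (β := 2 - α) (by linarith)
  have I2 := aux_int_far hd (β := k - α) (by linarith)
  set g1 : EuclideanSpace ℝ (Fin d) → ℝ := fun z =>
      (Iic (1:ℝ)).indicator (fun r => r ^ (2 - α - d)) ‖z‖ with hg1
  set g2 : EuclideanSpace ℝ (Fin d) → ℝ := fun z =>
      (Ici (1:ℝ)).indicator (fun r => r ^ (k - α - d)) ‖z‖ with hg2
  have g1n : ∀ z, 0 ≤ g1 z := fun z => by
    simp only [hg1, indicator]; split_ifs <;> positivity
  have g2n : ∀ z, 0 ≤ g2 z := fun z => by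
    simp only [hg2, indicator]; split_ifs <;> positivity
  set A := ∫ z, g1 z
  set B := ∫ z, g2 z
  have hA : 0 ≤ A := integral_nonneg g1n
  have hB : 0 ≤ B := integral_nonneg g2n
  refine ⟨4 * A + 2 * B + 1, by positivity, fun x => ?_⟩
  have N : |∫ z in {z : EuclideanSpace ℝ (Fin d) | ‖z‖ ≤ 1},
      ((1 + ‖x + z‖ ^ 2) ^ (k / 2) + (1 + ‖x - z‖ ^ 2) ^ (k / 2)
        - 2 * (1 + ‖x‖ ^ 2) ^ (k / 2)) / ‖z‖ ^ ((d : ℝ) + α)| ≤ 8 * A := by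
    have hms : MeasurableSet {z : EuclideanSpace ℝ (Fin d) | ‖z‖ ≤ 1} :=
      measurableSet_le measurable_norm measurable_const
    have h := norm_integral_le_of_norm_le (μ := volume.restrict
        {z : EuclideanSpace ℝ (Fin d) | ‖z‖ ≤ 1})
      (f := fun z => ((1 + ‖x + z‖ ^ 2) ^ (k / 2) + (1 + ‖x - z‖ ^ 2) ^ (k / 2)
        - 2 * (1 + ‖x‖ ^ 2) ^ (k / 2)) / ‖z‖ ^ ((d : ℝ) + α))
      ((I1.const_mul 8).restrict) ?_
    · refine h.trans ?_
      rw [← integral_const_mul]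
      exact setIntegral_le_integral (I1.const_mul 8)
        (Eventually.of_forall fun z => mul_nonneg (by norm_num) (g1n z))
    · filter_upwards [ae_restrict_mem hms] with z hz
      have hz : ‖z‖ ≤ 1 := hz
      rcases eq_or_ne z 0 with rfl | hz0
      · have : ((1 + ‖x + 0‖ ^ 2) ^ (k / 2) + (1 + ‖x - 0‖ ^ 2) ^ (k / 2)
          - 2 * (1 + ‖x‖ ^ 2) ^ (k / 2)) = 0 := by rw [add_zero, sub_zero]; ring
        rw [this, zero_div, norm_zero]
        exact mul_nonneg (by norm_num) (g1n 0)
      · have hzp : 0 < ‖z‖ := norm_pos_iff.2 hz0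
        have hgz : g1 z = ‖z‖ ^ 2 / ‖z‖ ^ ((d : ℝ) + α) := by
          simp only [hg1]
          rw [indicator_of_mem (show ‖z‖ ∈ Iic 1 from hz), ← Real.rpow_natCast,
            ← Real.rpow_sub hzp]
          congr 1; push_cast; ring
        change _ ≤ 8 * g1 z
        rw [hgz, norm_div, Real.norm_eq_abs, Real.norm_of_nonneg (by positivity), ← mul_div_assoc]
        gcongr
        exact aux_near hk0 hk2 x z
  have F : |∫ y in {y : EuclideanSpace ℝ (Fin d) | 1 ≤ ‖x - y‖},
      ((1 + ‖y‖ ^ 2) ^ (k / 2) - (1 + ‖x‖ ^ 2) ^ (k / 2)) / ‖x - y‖ ^ ((d : ℝ) + α)|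
      ≤ (2 * ‖x‖ ^ (k / 2) + 1) * B := by
    have hms : MeasurableSet {y : EuclideanSpace ℝ (Fin d) | 1 ≤ ‖x - y‖} :=
      measurableSet_le measurable_const (measurable_const.sub measurable_id).norm
    have I3 := (I2.comp_sub_left x).const_mul (2 * ‖x‖ ^ (k / 2) + 1)
    have h := norm_integral_le_of_norm_le (μ := volume.restrict
        {y : EuclideanSpace ℝ (Fin d) | 1 ≤ ‖x - y‖})
      (f := fun y => ((1 + ‖y‖ ^ 2) ^ (k / 2) - (1 + ‖x‖ ^ 2) ^ (k / 2))
        / ‖x - y‖ ^ ((d : ℝ) + α))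
      I3.restrict ?_
    · refine h.trans ?_
      rw [show B = _ from (integral_sub_left_eq_self g2 volume x).symm, ← integral_const_mul]
      exact setIntegral_le_integral I3
        (Eventually.of_forall fun z => mul_nonneg (by positivity) (g2n _))
    · filter_upwards [ae_restrict_mem hms] with y hy
      have hy : 1 ≤ ‖x - y‖ := hy
      have hyp : 0 < ‖x - y‖ := by linarith
      have hgz : g2 (x - y) = ‖x - y‖ ^ k / ‖x - y‖ ^ ((d : ℝ) + α) := by
        simp only [hg2]
        rw [indicator_of_mem (show ‖x - y‖ ∈ Ici 1 from hy), ← Real.rpow_sub hyp]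
        congr 1; ring
      rw [hgz, norm_div, Real.norm_eq_abs, Real.norm_of_nonneg (r := _ ^ _) (by positivity), ← mul_div_assoc]
      gcongr
      exact aux_far hk0 hk2 x y hy
  unfold fracLapWeight
  have hx : 0 ≤ ‖x‖ ^ (k / 2) := by positivity
  refine (abs_add_le _ _).trans ?_
  rw [abs_mul]
  have : |(-(1 / 2) : ℝ)| = 1 / 2 := by norm_num
  rw [this]
  nlinarith [mul_nonneg hA hx, mul_nonneg hB hx]

theorem stmt13 (d : ℕ) (hd : 1 ≤ d) (α : ℝ) (hα : α ∈ Set.Ioo (0:ℝ) 2)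
    (k : ℝ) (hk : k ∈ Set.Ioo 0 α) :
    Filter.Tendsto
      (fun x : EuclideanSpace ℝ (Fin d) => fracLapWeight d α k x / (1 + ‖x‖ ^ 2) ^ (k / 2))
      (Bornology.cobounded (EuclideanSpace ℝ (Fin d))) (nhds 0) ∧
    ∃ C > (0 : ℝ), ∀ x : EuclideanSpace ℝ (Fin d),
      |fracLapWeight d α k x| ≤
        C * ((1 + ‖x‖ ^ 2) ^ ((k - 2) / 2) + ‖x‖ ^ (k / 2) + 1) := by
  obtain ⟨C, hC, hb⟩ := aux_bound d hd α hα k hk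
  have hk0 : 0 < k := hk.1
  refine ⟨?_, C, hC, fun x => (hb x).trans ?_⟩
  · have ht : Tendsto (fun x : EuclideanSpace ℝ (Fin d) => 2 * C * ‖x‖ ^ (-(k / 2)))
        (Bornology.cobounded _) (nhds 0) := by
      have := ((tendsto_rpow_neg_atTop (show 0 < k / 2 by linarith)).comp
        (tendsto_norm_cobounded_atTop (E := EuclideanSpace ℝ (Fin d)))).const_mul (2 * C)
      simpa using this
    refine squeeze_zero_norm' ?_ ht
    filter_upwards [tendsto_norm_cobounded_atTop.eventually_ge_atTop 1] with x hx
    have hxp : 0 < ‖x‖ := by linarith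
    have h1 : 1 ≤ ‖x‖ ^ (k / 2) := Real.one_le_rpow hx (by linarith)
    have h2 : ‖x‖ ^ k ≤ (1 + ‖x‖ ^ 2) ^ (k / 2) := by
      calc ‖x‖ ^ k = (‖x‖ ^ 2) ^ (k / 2) := by
            rw [← Real.rpow_natCast, ← Real.rpow_mul hxp.le]; congr 1; push_cast; ring
        _ ≤ _ := Real.rpow_le_rpow (by positivity) (by linarith) (by linarith)
    rw [norm_div, Real.norm_eq_abs, Real.norm_of_nonneg (by positivity),
      div_le_iff₀ (by positivity)]
    calc |fracLapWeight d α k x| ≤ C * (‖x‖ ^ (k / 2) + 1) := hb x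
      _ ≤ 2 * C * ‖x‖ ^ (k / 2) := by nlinarith
      _ = 2 * C * ‖x‖ ^ (-(k / 2)) * ‖x‖ ^ k := by
          rw [mul_assoc (2 * C), ← Real.rpow_add hxp]; congr 2; ring
      _ ≤ _ := by gcongr
  · have : 0 ≤ (1 + ‖x‖ ^ 2) ^ ((k - 2) / 2) := by positivity
    gcongr
    linarith
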